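/- Let A be an associative ℂ-algebra, g ∈ A invertible, and suppose ad(g) is locally nilpotent on A. For z ∈ ℂ define Θ_z(u) = ∑_{j≥0} binom(z,j) (ad g)^j(u) g^{-j} (a finite sum for each u). Then Θ_z is an algebra homomorphism A → A, and Θ_z ∘ Θ_w = Θ_{z+w} for all z, w ∈ ℂ. -/

import Mathlib

/-- Generalized binomial coefficient `binom(z,j) = z(z-1)⋯(z-j+1)/j!` for `z ∈ ℂ`. -/
noncomputable def cbinom (z : ℂ) (j : ℕ) : ℂ :=
  (∏ k ∈ Finset.range j, (z - (k : ℂ))) / (j.factorial : ℂ)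

/-- The generalized conjugation `Θ_z(u) = ∑_{j≥0} binom(z,j) (ad g)^j(u) g^{-j}`. -/
noncomputable def Theta (A : Type*) [Ring A] [Algebra ℂ A] (g : Aˣ) (z : ℂ) (u : A) : A :=
  ∑ᶠ j : ℕ, cbinom z j • ((fun v : A => (g : A) * v - v * (g : A))^[j] u * ((g ^ (-(j : ℤ)) : Aˣ) : A))

open Polynomial in
noncomputable def cbPoly (j : ℕ) : ℂ[X] :=
  C ((j.factorial : ℂ)⁻¹) * ∏ k ∈ Finset.range j, (X - C (k : ℂ))

lemma cbPoly_eval (z : ℂ) (j : ℕ) : (cbPoly j).eval z = cbinom z j := by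
  simp [cbPoly, cbinom, Polynomial.eval_prod, div_eq_inv_mul]

lemma cbinom_eq_choose (z : ℂ) (j : ℕ) : cbinom z j = Ring.choose z j := by
  rw [Ring.choose_eq_smul, cbinom, div_eq_inv_mul, smul_eq_mul]
  congr 1
  induction j with
  | zero => simp
  | succ n ih => simp [Finset.prod_range_succ, ih, descPochhammer_succ_right, Polynomial.smeval_mul, Polynomial.smeval_sub, Polynomial.smeval_natCast]

lemma cbinom_add (z w : ℂ) (k : ℕ) :
    cbinom (z + w) k = ∑ i ∈ Finset.range (k + 1), cbinom z i * cbinom w (k - i) := by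
  simp only [cbinom_eq_choose]
  rw [Ring.add_choose_eq k (Commute.all z w),
    Finset.Nat.sum_antidiagonal_eq_sum_range_succ (fun i j => Ring.choose z i * Ring.choose w j)]

lemma cbinom_nat (n j : ℕ) : cbinom (n : ℂ) j = (n.choose j : ℂ) := by
  rw [cbinom_eq_choose, Ring.choose_natCast]

section
variable {A : Type*} [Ring A] [Algebra ℂ A] (g : Aˣ)

noncomputable def Dop : Module.End ℂ A :=
  LinearMap.mulLeft ℂ (g : A) * LinearMap.mulRight ℂ ((g⁻¹ : Aˣ) : A) - 1

lemma Dop_apply (u : A) : Dop g u = g * u * ((g⁻¹ : Aˣ) : A) - u := by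
  simp [Dop, mul_assoc]

lemma Dop_pow (j : ℕ) (u : A) :
    (fun v : A => (g : A) * v - v * (g : A))^[j] u * ((g ^ (-(j : ℤ)) : Aˣ) : A)
      = (Dop g ^ j) u := by
  induction j with
  | zero => simp
  | succ n ih =>
    rw [pow_succ', Module.End.mul_apply, ← ih, Dop_apply, Function.iterate_succ_apply']
    generalize (fun v : A => (g : A) * v - v * (g : A))^[n] u = x
    have h1 : (g ^ (-((n + 1 : ℕ) : ℤ)) : Aˣ) = g ^ (-(n : ℤ)) * g⁻¹ := by
      rw [← zpow_sub_one]; congr 1; push_cast; ring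
    have h2 : (g : Aˣ) * (g ^ (-(n : ℤ)) * g⁻¹) = g ^ (-(n : ℤ)) := by
      rw [← zpow_sub_one, ← zpow_one_add]; congr 1; ring
    rw [h1, sub_mul, mul_assoc x, ← Units.val_mul, h2]
    simp [mul_assoc]

lemma Theta_eq (z : ℂ) (u : A) : Theta A g z u = ∑ᶠ j : ℕ, cbinom z j • (Dop g ^ j) u := by
  simp only [Theta, Dop_pow]

lemma Dop_zero {N j : ℕ} {u : A} (h : (Dop g ^ N) u = 0) (hj : N ≤ j) : (Dop g ^ j) u = 0 := by
  obtain ⟨k, rfl⟩ := Nat.exists_eq_add_of_le' hj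
  rw [pow_add, Module.End.mul_apply, h, map_zero]

lemma Theta_sum (z : ℂ) {N : ℕ} {u : A} (h : (Dop g ^ N) u = 0) :
    Theta A g z u = ∑ j ∈ Finset.range N, cbinom z j • (Dop g ^ j) u := by
  rw [Theta_eq]
  apply finsum_eq_sum_of_support_subset
  intro j hj
  by_contra hc
  simp only [Finset.coe_range, Set.mem_Iio, not_lt] at hc
  exact hj (by simp [Dop_zero g h hc])

lemma Theta_nat (n : ℕ) (u : A) : Theta A g n u = ((Dop g + 1) ^ n) u := by
  rw [Theta_eq, finsum_eq_sum_of_support_subset (s := Finset.range (n + 1))]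
  · rw [(Commute.one_right (Dop g)).add_pow]
    simp only [LinearMap.sum_apply]
    refine Finset.sum_congr rfl fun j _ => ?_
    rw [cbinom_nat, one_pow, mul_one, ← nsmul_eq_mul', LinearMap.smul_apply, Nat.cast_smul_eq_nsmul]
  · intro j hj
    by_contra hc
    simp only [Finset.coe_range, Set.mem_Iio, not_lt] at hc
    exact hj (by simp [cbinom_nat, Nat.choose_eq_zero_of_lt hc])

lemma conj_pow_mul (n : ℕ) (u v : A) :
    ((Dop g + 1) ^ n) (u * v) = ((Dop g + 1) ^ n) u * ((Dop g + 1) ^ n) v := by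
  induction n with
  | zero => simp
  | succ n ih =>
    simp only [pow_succ', Module.End.mul_apply, ih]
    simp [Dop_apply, mul_assoc]

lemma Theta_mul (hD : ∀ u : A, ∃ n : ℕ, (Dop g ^ n) u = 0) (z : ℂ) (u v : A) :
    Theta A g z (u * v) = Theta A g z u * Theta A g z v := by
  obtain ⟨a, ha⟩ := hD u
  obtain ⟨b, hb⟩ := hD v
  obtain ⟨c, hc⟩ := hD (u * v)
  rw [← sub_eq_zero, ← Module.forall_dual_apply_eq_zero_iff ℂ]
  intro f
  rw [map_sub, sub_eq_zero]
  let P : Polynomial ℂ := ∑ j ∈ Finset.range c, cbPoly j * Polynomial.C (f ((Dop g ^ j) (u * v)))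
  let Q : Polynomial ℂ := ∑ i ∈ Finset.range a, ∑ j ∈ Finset.range b,
    cbPoly i * cbPoly j * Polynomial.C (f ((Dop g ^ i) u * (Dop g ^ j) v))
  have hP : ∀ z, P.eval z = f (Theta A g z (u * v)) := by
    intro z
    rw [Theta_sum g z hc]
    simp [P, Polynomial.eval_finsetSum, cbPoly_eval]
  have hQ : ∀ z, Q.eval z = f (Theta A g z u * Theta A g z v) := by
    intro z
    rw [Theta_sum g z ha, Theta_sum g z hb, Finset.sum_mul_sum]
    simp only [Q, Polynomial.eval_finsetSum, cbPoly_eval, map_sum, smul_mul_smul_comm, map_smul,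
      Polynomial.eval_mul, Polynomial.eval_C, smul_eq_mul]
  have hPQ : P = Q := by
    apply Polynomial.eq_of_infinite_eval_eq
    refine (Set.infinite_range_of_injective (Nat.cast_injective (R := ℂ))).mono ?_
    rintro _ ⟨n, rfl⟩
    simp only [Set.mem_ofPred_eq]
    rw [hP, hQ, Theta_nat, Theta_nat, Theta_nat, conj_pow_mul]
  rw [← hP, ← hQ, hPQ]

lemma Theta_comp (hD : ∀ u : A, ∃ n : ℕ, (Dop g ^ n) u = 0) (z w : ℂ) (u : A) :
    Theta A g z (Theta A g w u) = Theta A g (z + w) u := by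
  obtain ⟨N, hN⟩ := hD u
  have h2 : (Dop g ^ N) (Theta A g w u) = 0 := by
    rw [Theta_sum g w hN, map_sum]
    refine Finset.sum_eq_zero fun j _ => ?_
    rw [map_smul, ← Module.End.mul_apply, ← pow_add, Dop_zero g hN (by omega), smul_zero]
  rw [Theta_sum g z h2, Theta_sum g w hN, Theta_sum g (z + w) hN]
  have h3 : ∀ k ∈ Finset.range N, cbinom (z + w) k • (Dop g ^ k) u =
      ∑ i ∈ Finset.range (k + 1),
        (fun i j => (cbinom z i * cbinom w j) • (Dop g ^ (i + j)) u) i (k - i) := by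
    intro k _
    rw [cbinom_add, Finset.sum_smul]
    refine Finset.sum_congr rfl fun i hi => ?_
    have : i + (k - i) = k := by have := Finset.mem_range.1 hi; omega
    simp only [this]
  rw [Finset.sum_congr rfl h3,
    Finset.sum_range_diag_flip N (fun i j => (cbinom z i * cbinom w j) • (Dop g ^ (i + j)) u)]
  refine Finset.sum_congr rfl fun i _ => ?_
  rw [map_sum, Finset.smul_sum]
  symm
  have h4 : ∀ j, cbinom z i • (Dop g ^ i) (cbinom w j • (Dop g ^ j) u) =
      (cbinom z i * cbinom w j) • (Dop g ^ (i + j)) u := by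
    intro j
    rw [map_smul, smul_smul, pow_add, Module.End.mul_apply]
  simp only [h4]
  apply Finset.sum_subset
  · intro j; simp only [Finset.mem_range]; omega
  · intro j _ hj
    simp only [Finset.mem_range, not_lt] at hj
    rw [Dop_zero g hN (by omega), smul_zero]

end

/-- if `ad g` is locally nilpotent on `A` then `Θ_z` is an algebra
homomorphism `A → A` and `Θ_z ∘ Θ_w = Θ_{z+w}`. -/
theorem stmt12 (A : Type*) [Ring A] [Algebra ℂ A] (g : Aˣ)
    (hnil : ∀ u : A, ∃ n : ℕ, (fun v : A => (g : A) * v - v * (g : A))^[n] u = 0)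
    (z w : ℂ) :
    (∀ u v : A, Theta A g z (u + v) = Theta A g z u + Theta A g z v) ∧
    (∀ (c : ℂ) (u : A), Theta A g z (c • u) = c • Theta A g z u) ∧
    (∀ u v : A, Theta A g z (u * v) = Theta A g z u * Theta A g z v) ∧
    Theta A g z 1 = 1 ∧
    (∀ u : A, Theta A g z (Theta A g w u) = Theta A g (z + w) u) := by
  have hD : ∀ u : A, ∃ n : ℕ, (Dop g ^ n) u = 0 := by
    intro u
    obtain ⟨n, hn⟩ := hnil u
    exact ⟨n, by rw [← Dop_pow, hn, zero_mul]⟩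
  refine ⟨?_, ?_, Theta_mul g hD z, ?_, Theta_comp g hD z w⟩
  · intro u v
    obtain ⟨a, ha⟩ := hD u
    obtain ⟨b, hb⟩ := hD v
    have ha' := Dop_zero g ha (le_max_left a b)
    have hb' := Dop_zero g hb (le_max_right a b)
    have hc : (Dop g ^ (max a b)) (u + v) = 0 := by rw [map_add, ha', hb', add_zero]
    rw [Theta_sum g z ha', Theta_sum g z hb', Theta_sum g z hc, ← Finset.sum_add_distrib]
    simp only [map_add, smul_add]
  · intro c u
    obtain ⟨a, ha⟩ := hD u
    have hc : (Dop g ^ a) (c • u) = 0 := by rw [map_smul, ha, smul_zero]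
    rw [Theta_sum g z ha, Theta_sum g z hc, Finset.smul_sum]
    simp only [map_smul, smul_comm c]
  · have h1 : (Dop g ^ 1) (1 : A) = 0 := by simp [Dop_apply]
    rw [Theta_sum g z h1]
    simp [cbinom]
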